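/- Let (f_w) denote the sequence of normalized extremal quasimodular forms of depth 1 and even weight w ≥ 6. Then for w ≡ 0 (mod 6): f_6 = (E_2E_4 − E_6)/720, and the recursion f_{w+6} = ((w+6)/(72(w+1)(w+5))) · (E_4 ∂_{w−1} f_w − ((w+1)/12) E_6 f_w) holds. Furthermore f_{w+2} = (12/(w+1)) ∂_{w−1} f_w and f_{w+4} = E_4 f_w. -/

import Mathlib

open Complex UpperHalfPlane Finset
open scoped Manifold MatrixGroups Real

noncomputable section

/-- The nome `q = e^{2πiz}`. -/
def qexp (z : ℍ) : ℂ := Complex.exp (2 * Real.pi * Complex.I * z)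

/-- The normalized Eisenstein series `E_k` (for even `k ≥ 2`), defined via its
`q`-expansion `E_k = 1 - (2k/B_k) ∑_{n ≥ 1} σ_{k-1}(n) q^n`. -/
def Eis (k : ℕ) (z : ℍ) : ℂ :=
  1 - (2 * k / ((bernoulli k : ℚ) : ℂ)) *
    ∑' n : ℕ, (ArithmeticFunction.sigma (k - 1) (n + 1) : ℂ) * qexp z ^ (n + 1)

/-- The modular discriminant `Δ = (E_4³ − E_6²)/1728`. -/
def Disc (z : ℍ) : ℂ := (Eis 4 z ^ 3 - Eis 6 z ^ 2) / 1728

/-- The space of holomorphic modular forms of weight `w` for the full modular group,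
as a set of functions on `ℍ`. -/
def Mset (w : ℤ) : Set (ℍ → ℂ) :=
  {f | ∃ F : ModularForm (⊤ : Subgroup SL(2, ℤ)) w, ⇑F = f}

/-- The set of quasimodular forms of weight `w` and depth `≤ r`:
functions of the form `∑_{ℓ=0}^r E_2^ℓ h_ℓ` with `h_ℓ ∈ M_{w-2ℓ}`. -/
def QMset (w : ℤ) (r : ℕ) : Set (ℍ → ℂ) :=
  {f | ∃ h : ℕ → ℍ → ℂ, (∀ ℓ ≤ r, h ℓ ∈ Mset (w - 2 * ℓ)) ∧
        ∀ z, f z = ∑ ℓ ∈ Finset.range (r + 1), Eis 2 z ^ ℓ * h ℓ z}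

/-- `QM_w^r` as a `ℂ`-subspace of the functions on `ℍ`. -/
def QM (w : ℤ) (r : ℕ) : Submodule ℂ (ℍ → ℂ) := Submodule.span ℂ (QMset w r)

/-- `dim QM_w^r`. -/
def dimQM (w : ℤ) (r : ℕ) : ℕ := Module.finrank ℂ (QM w r)

/-- The complex derivative of a function on `ℍ` (via an extension to `ℂ`; since `ℍ` is
open in `ℂ` this agrees with the complex derivative for holomorphic `f`). -/
def hderiv (f : ℍ → ℂ) (z : ℍ) : ℂ :=
  deriv (fun w : ℂ => if h : 0 < w.im then f ⟨w, h⟩ else 0) z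

/-- The normalized derivative `f' = (2πi)⁻¹ df/dz = q df/dq`. -/
def qderiv (f : ℍ → ℂ) (z : ℍ) : ℂ := (2 * Real.pi * Complex.I)⁻¹ * hderiv f z

/-- The Serre derivative `∂_w f = f' - (w/12) E_2 f`. -/
def serre (w : ℤ) (f : ℍ → ℂ) (z : ℍ) : ℂ :=
  qderiv f z - ((w : ℂ) / 12) * Eis 2 z * f z

/-- Iterated Serre derivatives: `∂_w^0 f = f`, `∂_w^{k+1} f = ∂_{w+2k}(∂_w^k f)`. -/
def serreIter (w : ℤ) : ℕ → (ℍ → ℂ) → (ℍ → ℂ)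
  | 0, f => f
  | (k + 1), f => serre (w + 2 * k) (serreIter w k f)

/-- `z ↦ -1/z` as a map `ℍ → ℍ`. -/
def Sact (z : ℍ) : ℍ :=
  ⟨-(z : ℂ)⁻¹, by
    have h0 : (z : ℂ) ≠ 0 := z.ne_zero
    have : (-(z : ℂ)⁻¹).im = (z : ℂ).im / Complex.normSq (z : ℂ) := by
      rw [Complex.neg_im, Complex.inv_im]; ring
    rw [this]
    exact div_pos z.im_pos (Complex.normSq_pos.mpr h0)⟩

/-- `z ↦ z + 1` as a map `ℍ → ℍ`. -/
def Tact (z : ℍ) : ℍ := ⟨(z : ℂ) + 1, by simpa using z.im_pos⟩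

/-- `g` has a `q`-expansion with vanishing order exactly `ν` at `i∞`:
`g = q^ν ∑_{n≥0} a(n) qⁿ` with `a(0) ≠ 0`. -/
def HasQExpansionAt (g : ℍ → ℂ) (ν : ℕ) : Prop :=
  ∃ a : ℕ → ℂ, a 0 ≠ 0 ∧ ∀ z : ℍ, HasSum (fun n : ℕ => a n * qexp z ^ (ν + n)) (g z)

/-- The quasimodular forms `g_ℓ` attached to `f = ∑_{ℓ=0}^r E_2^ℓ h_ℓ`, defined by
`C(r,ℓ) g_ℓ = (6/(πi))^ℓ ∑_{m=0}^{r-ℓ} C(ℓ+m,m) E_2^m h_{ℓ+m}`. -/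
def gOf (r : ℕ) (h : ℕ → ℍ → ℂ) (ℓ : ℕ) (z : ℍ) : ℂ :=
  ((r.choose ℓ : ℂ))⁻¹ * (6 / ((Real.pi : ℂ) * Complex.I)) ^ ℓ *
    ∑ m ∈ Finset.range (r - ℓ + 1), (((ℓ + m).choose m : ℕ) : ℂ) * Eis 2 z ^ m * h (ℓ + m) z

/-- `f` is a balanced quasimodular form of weight `w` and depth `r`. -/
def IsBalancedQM (w : ℤ) (r : ℕ) (f : ℍ → ℂ) : Prop :=
  ∃ h : ℕ → ℍ → ℂ, ∃ lam : ℕ → ℕ,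
    (∀ ℓ ≤ r, h ℓ ∈ Mset (w - 2 * ℓ)) ∧ h r ≠ 0 ∧
    (∀ z, f z = ∑ ℓ ∈ Finset.range (r + 1), Eis 2 z ^ ℓ * h ℓ z) ∧
    (∀ ℓ ≤ r, HasQExpansionAt (gOf r h ℓ) (lam ℓ)) ∧
    (∀ i j, i ≤ j → j ≤ r → lam j ≤ lam i) ∧
    (∀ ℓ ≤ r, lam ℓ < dimQM (w - 2 * ℓ) (r - ℓ)) ∧
    (∑ ℓ ∈ Finset.range (r + 1), lam ℓ) = dimQM w r - 1

/-- `f` is the normalized extremal quasimodular form of weight `w` and depth `r`: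
`f ∈ QM_w^r` with `q`-expansion `q^{dim QM_w^r - 1}(1 + O(q))`. -/
def IsNormalizedExtremalQM (w : ℤ) (r : ℕ) (f : ℍ → ℂ) : Prop :=
  f ∈ QM w r ∧ ∃ a : ℕ → ℂ, a 0 = 1 ∧
    ∀ z : ℍ, HasSum (fun n : ℕ => a n * qexp z ^ (dimQM w r - 1 + n)) (f z)

/-- `f 0, …, f (n-1)` is a fundamental system of solutions of the linear differential
equation `K g = 0`: holomorphic linearly independent solutions spanning all
holomorphic solutions. -/
def IsFundamentalSystem {n : ℕ} (K : (ℍ → ℂ) → (ℍ → ℂ)) (f : Fin n → ℍ → ℂ) : Prop :=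
  (∀ i, MDifferentiable 𝓘(ℂ) 𝓘(ℂ) (f i)) ∧ (∀ i, K (f i) = 0) ∧
    LinearIndependent ℂ f ∧
    ∀ g : ℍ → ℂ, MDifferentiable 𝓘(ℂ) 𝓘(ℂ) g → K g = 0 → g ∈ Submodule.span ℂ (Set.range f)


/-- `F = (f_0, …, f_r)ᵀ` is a quasimodular vector of weight `w` and dimension `r+1`:
all components are holomorphic and there is a quasimodular form `f = ∑_{ℓ=0}^s E_2^ℓ h_ℓ`
of weight `w` and depth `s ≤ r` such that
`f_k(z) = ∑_{ℓ=0}^{min(k,s)} C(k,ℓ) z^{k-ℓ} g_ℓ(z)` for the attached forms `g_ℓ`. -/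
def IsQuasimodularVector (w : ℤ) (r : ℕ) (F : Fin (r + 1) → ℍ → ℂ) : Prop :=
  (∀ k, MDifferentiable 𝓘(ℂ) 𝓘(ℂ) (F k)) ∧
  ∃ s : ℕ, s ≤ r ∧ ∃ h : ℕ → ℍ → ℂ,
    (∀ ℓ ≤ s, h ℓ ∈ Mset (w - 2 * ℓ)) ∧ (s = 0 ∨ h s ≠ 0) ∧
    ∀ (k : Fin (r + 1)) (z : ℍ),
      F k z = ∑ ℓ ∈ Finset.range (min (k : ℕ) s + 1),
        (((k : ℕ).choose ℓ : ℕ) : ℂ) * (z : ℂ) ^ ((k : ℕ) - ℓ) * gOf s h ℓ z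

/-- The modular Wronskian `W(z) = det(F, ∂_{w-r}F, …, ∂_{w-r}^r F)`. -/
def modularWronskian (w : ℤ) (r : ℕ) (F : Fin (r + 1) → ℍ → ℂ) (z : ℍ) : ℂ :=
  Matrix.det (Matrix.of fun (k j : Fin (r + 1)) => serreIter (w - r) (j : ℕ) (F k) z)

end

open PowerSeries in
/-- The derivation `q d/dq` on formal power series. -/
noncomputable def qD (p : PowerSeries ℂ) : PowerSeries ℂ := X * derivative ℂ p

lemma coeff_qD (p : PowerSeries ℂ) (n : ℕ) : (qD p).coeff n = n * p.coeff n := by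
  cases n with
  | zero => simp [qD]
  | succ n => simp [qD, PowerSeries.coeff_succ_X_mul, PowerSeries.coeff_derivative, mul_comm]

lemma qD_mul (p r : PowerSeries ℂ) : qD (p * r) = p * qD r + qD p * r := by
  simp only [qD, Derivation.leibniz, smul_eq_mul]
  ring

lemma qD_add (p r : PowerSeries ℂ) : qD (p + r) = qD p + qD r := by
  simp only [qD, map_add, mul_add]

lemma qD_X_pow_mul (n : ℕ) (u : PowerSeries ℂ) :
    qD (PowerSeries.X ^ n * u) = PowerSeries.X ^ n * (qD u + (n : ℂ) • u) := by
  ext m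
  simp only [coeff_qD, PowerSeries.coeff_X_pow_mul', map_add, map_smul, smul_eq_mul]
  split_ifs with h
  · rw [Nat.cast_sub h]; ring
  · simp

/-- The function `f` on the upper half plane is the sum of the power series `p` in the nome. -/
def HasQSeries (p : PowerSeries ℂ) (f : ℍ → ℂ) : Prop :=
  ∀ z : ℍ, HasSum (fun n : ℕ => p.coeff n * qexp z ^ n) (f z)

lemma qexp_eq_qParam (z : ℍ) : qexp z = Function.Periodic.qParam 1 z := by
  simp [qexp, Function.Periodic.qParam]

namespace HasQSeries

variable {p r : PowerSeries ℂ} {f g : ℍ → ℂ}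

lemma add (hf : HasQSeries p f) (hg : HasQSeries r g) : HasQSeries (p + r) (f + g) := fun z => by
  simpa [add_mul] using (hf z).add (hg z)

lemma smul (c : ℂ) (hf : HasQSeries p f) : HasQSeries (c • p) (c • f) := fun z => by
  simpa [mul_assoc] using (hf z).mul_left c

lemma sub (hf : HasQSeries p f) (hg : HasQSeries r g) : HasQSeries (p - r) (f - g) := fun z => by
  simpa [sub_mul] using (hf z).sub (hg z)

lemma mul (hf : HasQSeries p f) (hg : HasQSeries r g) : HasQSeries (p * r) (f * g) := fun z => by
  have hp := (hf z).summable.norm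
  have hr := (hg z).summable.norm
  have hs := (summable_norm_sum_mul_antidiagonal_of_summable_norm hp hr).of_norm.hasSum
  rw [← tsum_mul_tsum_eq_tsum_sum_antidiagonal_of_summable_norm hp hr, (hf z).tsum_eq,
    (hg z).tsum_eq] at hs
  convert! hs using 1
  ext n
  rw [PowerSeries.coeff_mul, Finset.sum_mul]
  refine Finset.sum_congr rfl fun x hx => ?_
  rw [← Finset.HasAntidiagonal.mem_antidiagonal.mp hx, pow_add]
  ring

lemma eq_fun (hf : HasQSeries p f) (hg : HasQSeries p g) : f = g :=
  funext fun z => (hf z).unique (hg z)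

lemma isBoundedAtImInfty (hf : HasQSeries p f) : IsBoundedAtImInfty f :=
  isBoundedAtImInfty_of_hasSum_qExpansion one_pos (c := fun n => p.coeff n) fun z => by
    simpa [qexp_eq_qParam] using hf z

lemma eq_qExpansion {k : ℤ} {F : ModularForm 𝒮ℒ k} (hF : HasQSeries p F) :
    p = qExpansion 1 F := by
  ext n
  refine ModularFormClass.qExpansion_coeff_unique (Γ := 𝒮ℒ) (k := k)
    (c := fun n => p.coeff n) one_pos one_mem_strictPeriods_SL (fun z => ?_) n
  simpa [qexp_eq_qParam] using hF z

lemma eq_series (hf : HasQSeries p f) (hg : HasQSeries r f) : p = r := by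
  have h : HasQSeries (p - r) ⇑(0 : ModularForm 𝒮ℒ 0) := by
    have := hf.sub hg
    rwa [sub_self] at this
  rw [← sub_eq_zero, h.eq_qExpansion]
  exact qExpansion_zero 1

lemma _root_.ModularForm.hasQSeries {k : ℤ} (F : ModularForm 𝒮ℒ k) :
    HasQSeries (qExpansion 1 F) F := fun z => by
  simpa [qexp_eq_qParam] using
    ModularForm.hasSum_qExpansion (f := F) one_pos one_mem_strictPeriods_SL z

end HasQSeries

lemma hderiv_eq (f : ℍ → ℂ) (z : ℍ) : hderiv f z = deriv (f ∘ ofComplex) z := by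
  refine Filter.EventuallyEq.deriv_eq ?_
  filter_upwards [isOpen_upperHalfPlaneSet.mem_nhds z.im_pos] with w hw
  have hw' : 0 < w.im := hw
  simp [hw', ofComplex_apply_of_im_pos hw']

lemma qderiv_eq (f : ℍ → ℂ) : qderiv f = Derivative.normalizedDerivOfComplex f := by
  ext z
  simp [qderiv, Derivative.normalizedDerivOfComplex, hderiv_eq]

lemma norm_qexp (z : ℍ) : ‖qexp z‖ = Real.exp (-2 * π * z.im) := by
  simp [qexp, Complex.norm_exp]

lemma HasQSeries.qderiv {p : PowerSeries ℂ} {f : ℍ → ℂ} (hf : HasQSeries p f) :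
    HasQSeries (qD p) (qderiv f) := fun z => by
  let z' : ℍ := ⟨Complex.I * (z.im / 2), by simpa using z.im_pos⟩
  have hz' : z'.im = z.im / 2 := by
    rw [← coe_im]
    simp [z']
  set U : Set ℂ := {w | z.im / 2 < w.im}
  have hU : IsOpen U := isOpen_lt continuous_const Complex.continuous_im
  have hzU : (z : ℂ) ∈ U := by
    have := z.im_pos
    simp only [U, Set.mem_ofPred_eq, coe_im]
    linarith
  have key := hasSum_deriv_of_summable_norm (z := (z : ℂ)) (U := U)
    (F := fun (n : ℕ) (w : ℂ) => p.coeff n * Complex.exp (2 * π * Complex.I * w) ^ n)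
    (hf z').summable.norm (fun n => by fun_prop) hU (fun n w hw => ?_) hzU
  · have hval : deriv (fun w : ℂ => ∑' n : ℕ, p.coeff n *
        Complex.exp (2 * π * Complex.I * w) ^ n) z = hderiv f z := by
      rw [hderiv_eq]
      refine Filter.EventuallyEq.deriv_eq ?_
      filter_upwards [isOpen_upperHalfPlaneSet.mem_nhds z.im_pos] with w hw
      have hw' : 0 < w.im := hw
      simpa [qexp, ofComplex_apply_of_im_pos hw'] using (hf ⟨w, hw'⟩).tsum_eq
    rw [hval] at key
    convert! key.mul_left (2 * Real.pi * Complex.I)⁻¹ using 1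
    ext n
    have hd : HasDerivAt (fun w : ℂ => p.coeff n * Complex.exp (2 * π * Complex.I * w) ^ n)
        (p.coeff n * (n * Complex.exp (2 * π * Complex.I * z) ^ (n - 1) *
          (Complex.exp (2 * π * Complex.I * z) * (2 * π * Complex.I * 1)))) z :=
      ((((hasDerivAt_id (z : ℂ)).const_mul (2 * π * Complex.I)).cexp).pow n).const_mul _
    rw [hd.deriv, coeff_qD, qexp]
    have hpi : (2 * Real.pi * Complex.I : ℂ) ≠ 0 := Complex.two_pi_I_ne_zero
    rcases n with _ | n
    · simp
    · rw [Nat.add_sub_cancel, pow_succ]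
      field_simp
  · rw [norm_mul, norm_mul, norm_pow, norm_pow, norm_qexp, hz']
    gcongr
    rw [Complex.norm_exp]
    have : z.im / 2 < w.im := hw
    simp
    gcongr

open scoped ModularForm
open Derivative

lemma mem_Mset_iff {k : ℤ} {f : ℍ → ℂ} : f ∈ Mset k ↔ ∃ F : ModularForm 𝒮ℒ k, ⇑F = f := by
  have h : ((⊤ : Subgroup SL(2, ℤ)) : Subgroup (GL (Fin 2) ℝ)) = 𝒮ℒ :=
    (MonoidHom.range_eq_map _).symm
  rw [Mset, h]
  rfl

lemma ModularForm.mem_Mset {k : ℤ} (F : ModularForm 𝒮ℒ k) : ⇑F ∈ Mset k :=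
  mem_Mset_iff.mpr ⟨F, rfl⟩

lemma mem_Mset_of_slash {k : ℤ} {f : ℍ → ℂ} (hd : MDiff f)
    (hs : ∀ γ : SL(2, ℤ), f ∣[k] γ = f) (hb : IsBoundedAtImInfty f) : f ∈ Mset k :=
  mem_Mset_iff.mpr ⟨{
    toFun := f
    slash_action_eq' := fun _ ⟨γ, hγ⟩ => hγ ▸ hs γ
    holo' := hd
    bdd_at_cusps' := fun {c} hc => by
      rw [OnePoint.isBoundedAt_iff_forall_SL2Z hc]
      intro γ _
      rwa [hs γ] }, rfl⟩

lemma Eis_eq_E {k : ℕ} (hk : 3 ≤ k) (hk2 : Even k) : Eis k = ⇑(ModularForm.E hk) := by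
  ext z
  simp only [EisensteinSeries.q_expansion_bernoulli hk hk2, Eis, zpow_natCast]
  rw [tsum_pnat_eq_tsum_succ (f := fun n : ℕ => (ArithmeticFunction.sigma (k - 1) n : ℂ) *
      Complex.exp (2 * π * Complex.I * z) ^ n)]
  rfl

lemma Eis_two : Eis 2 = EisensteinSeries.E2 := by
  ext z
  rw [EisensteinSeries.E2_eq_tsum_cexp, Eis,
    tsum_pnat_eq_tsum_succ (f := fun n : ℕ => (ArithmeticFunction.sigma 1 n : ℂ) *
      Complex.exp (2 * π * Complex.I * z) ^ n)]
  simp [qexp, bernoulli_two]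
  norm_num

lemma serre_eq (k : ℤ) (f : ℍ → ℂ) : serre k f = serreDerivative k f := by
  ext z
  simp only [serre, serreDerivative_apply, qderiv_eq, Eis_two]
  ring

lemma Eis_mem_Mset {k : ℕ} (hk : 3 ≤ k) (hk2 : Even k) : Eis k ∈ Mset k :=
  Eis_eq_E hk hk2 ▸ (ModularForm.E hk).mem_Mset

lemma Eis_four_mem_Mset : Eis 4 ∈ Mset 4 := Eis_mem_Mset (k := 4) (by norm_num) ⟨2, rfl⟩

lemma Eis_six_mem_Mset : Eis 6 ∈ Mset 6 := Eis_mem_Mset (k := 6) (by norm_num) ⟨3, rfl⟩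

lemma mdifferentiable_Eis_two : MDiff (Eis 2) := Eis_two ▸ E2_mdifferentiable

/-- The power series of `Eis 2`. -/
noncomputable def eisTwoSeries : PowerSeries ℂ :=
  .mk fun n => if n = 0 then 1 else -24 * ArithmeticFunction.sigma 1 n

lemma hasQSeries_Eis_two : HasQSeries eisTwoSeries (Eis 2) := fun z => by
  simpa [eisTwoSeries, Eis_two, qexp] using EisensteinSeries.hasSum_qExpansion_E2 (z := z)

namespace Mset

variable {k l : ℤ} {f g : ℍ → ℂ}

lemma add (hf : f ∈ Mset k) (hg : g ∈ Mset k) : f + g ∈ Mset k := by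
  obtain ⟨F, rfl⟩ := mem_Mset_iff.mp hf
  obtain ⟨G, rfl⟩ := mem_Mset_iff.mp hg
  exact (F + G).mem_Mset

lemma sub (hf : f ∈ Mset k) (hg : g ∈ Mset k) : f - g ∈ Mset k := by
  obtain ⟨F, rfl⟩ := mem_Mset_iff.mp hf
  obtain ⟨G, rfl⟩ := mem_Mset_iff.mp hg
  exact (F - G).mem_Mset

lemma smul (c : ℂ) (hf : f ∈ Mset k) : c • f ∈ Mset k := by
  obtain ⟨F, rfl⟩ := mem_Mset_iff.mp hf
  exact (c • F).mem_Mset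

lemma mul {m : ℤ} (hm : k + l = m) (hf : f ∈ Mset k) (hg : g ∈ Mset l) : f * g ∈ Mset m := by
  subst hm
  obtain ⟨F, rfl⟩ := mem_Mset_iff.mp hf
  obtain ⟨G, rfl⟩ := mem_Mset_iff.mp hg
  exact (F.mul G).mem_Mset

lemma mdifferentiable (hf : f ∈ Mset k) : MDiff f := by
  obtain ⟨F, rfl⟩ := mem_Mset_iff.mp hf
  exact F.holo'

lemma exists_hasQSeries (hf : f ∈ Mset k) : ∃ p, HasQSeries p f := by
  obtain ⟨F, rfl⟩ := mem_Mset_iff.mp hf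
  exact ⟨_, F.hasQSeries⟩

lemma slash (hf : f ∈ Mset k) (γ : SL(2, ℤ)) : f ∣[k] γ = f := by
  obtain ⟨F, rfl⟩ := mem_Mset_iff.mp hf
  exact F.slash_action_eq' _ ⟨γ, rfl⟩

end Mset

lemma serre_eq_qderiv_sub (k : ℤ) (f : ℍ → ℂ) :
    serre k f = qderiv f - ((k : ℂ) / 12) • (Eis 2 * f) := by
  ext z
  simp [serre, mul_assoc]

lemma HasQSeries.serre (k : ℤ) {p : PowerSeries ℂ} {f : ℍ → ℂ} (hf : HasQSeries p f) :
    HasQSeries (qD p - ((k : ℂ) / 12) • (eisTwoSeries * p)) (serre k f) := by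
  rw [serre_eq_qderiv_sub]
  exact hf.qderiv.sub ((hasQSeries_Eis_two.mul hf).smul _)

lemma Mset.serre {k : ℤ} {f : ℍ → ℂ} (hf : f ∈ Mset k) : serre k f ∈ Mset (k + 2) := by
  obtain ⟨p, hp⟩ := Mset.exists_hasQSeries hf
  refine mem_Mset_of_slash ?_ (fun γ => ?_) (hp.serre k).isBoundedAtImInfty
  · rw [serre_eq]
    exact serreDerivative_mdifferentiable _ (Mset.mdifferentiable hf)
  · rw [serre_eq]
    exact serreDerivative_slash_invariant (Mset.mdifferentiable hf) (Mset.slash hf γ)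

lemma Eis_two_slash (γ : SL(2, ℤ)) (z : ℍ) :
    (Eis 2 ∣[(2 : ℤ)] γ) z = Eis 2 z - 6 * Complex.I / π * (γ 1 0 / denom γ z) := by
  rw [Eis_two, EisensteinSeries.E2_slash_action, Pi.sub_apply, Pi.smul_apply,
    EisensteinSeries.D2, riemannZeta_two, smul_eq_mul]
  have : (π : ℂ) ≠ 0 := by exact_mod_cast Real.pi_ne_zero
  field_simp

lemma normalizedDeriv_Eis_two_slash (γ : SL(2, ℤ)) (z : ℍ) :
    normalizedDerivOfComplex (Eis 2 ∣[(2 : ℤ)] γ) z =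
      normalizedDerivOfComplex (Eis 2) z + 3 / π ^ 2 * (γ 1 0 / denom γ z) ^ 2 := by
  have h1 : HasDerivAt (Eis 2 ∘ ofComplex) (deriv (Eis 2 ∘ ofComplex) z) z :=
    (mdifferentiableAt_iff.mp (mdifferentiable_Eis_two z)).hasDerivAt
  have h2 := hasDerivAt_denom_zpow (γ : GL (Fin 2) ℝ) (-1) z
  have h3 := h1.sub (h2.const_mul (6 * Complex.I / π * (γ 1 0 : ℂ)))
  have hcomp : (Eis 2 ∣[(2 : ℤ)] γ) ∘ ofComplex =ᶠ[nhds (z : ℂ)]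
      fun w => (Eis 2 ∘ ofComplex) w - 6 * Complex.I / π * (γ 1 0 : ℂ) *
        denom (γ : GL (Fin 2) ℝ) w ^ (-1 : ℤ) := by
    filter_upwards [isOpen_upperHalfPlaneSet.mem_nhds z.im_pos] with w hw
    have hw' : 0 < w.im := hw
    simp only [Function.comp_apply, Eis_two_slash, ofComplex_apply_of_im_pos hw']
    rw [zpow_neg_one]
    ring
  simp only [normalizedDerivOfComplex]
  rw [(h3.congr_of_eventuallyEq hcomp).deriv]
  have hπ : (π : ℂ) ≠ 0 := by exact_mod_cast Real.pi_ne_zero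
  have hden := denom_ne_zero (γ : GL (Fin 2) ℝ) z
  simp
  field_simp
  linear_combination (-6 * (γ 1 0 : ℂ) ^ 2) * Complex.I_sq

lemma serre_one_Eis_two_mem : serre 1 (Eis 2) ∈ Mset 4 := by
  refine mem_Mset_of_slash ?_ (fun γ => ?_) (hasQSeries_Eis_two.serre 1).isBoundedAtImInfty
  · rw [serre_eq]
    exact serreDerivative_mdifferentiable _ mdifferentiable_Eis_two
  · ext z
    have h1 := congrFun (normalizedDerivOfComplex_SL_slash (k := 2) mdifferentiable_Eis_two
      (γ := γ)) z
    rw [normalizedDeriv_Eis_two_slash, Pi.sub_apply, Eis_two_slash] at h1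
    have h2 := congrFun (ModularForm.mul_slash_SL2 2 2 γ (Eis 2) (Eis 2)) z
    rw [Pi.mul_apply, Eis_two_slash] at h2
    have e : serre 1 (Eis 2) =
        normalizedDerivOfComplex (Eis 2) + (-(1 / 12) : ℂ) • (Eis 2 * Eis 2) := by
      ext z
      simp only [serre, qderiv_eq, Pi.add_apply, Pi.smul_apply, Pi.mul_apply, smul_eq_mul]
      push_cast
      ring
    rw [e, SlashAction.add_slash, ModularForm.SL_smul_slash]
    simp only [Pi.add_apply, Pi.smul_apply, smul_eq_mul, Pi.mul_apply]
    norm_num at h1 h2 ⊢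
    linear_combination -h1 - h2 / 12 +
      (3 * (γ 1 0 / denom γ z) ^ 2 / π ^ 2 : ℂ) * Complex.I_sq

lemma Mset.eq_zero_of_X_pow_dvd {k : ℤ} {f : ℍ → ℂ} {p : PowerSeries ℂ} {n : ℕ} (hf : f ∈ Mset k)
    (hp : HasQSeries p f) (hn : k.toNat / 12 < n) (hdvd : PowerSeries.X ^ n ∣ p) : f = 0 := by
  obtain ⟨F, rfl⟩ := mem_Mset_iff.mp hf
  rw [hp.eq_qExpansion, PowerSeries.X_pow_dvd_iff] at hdvd
  have hord : (n : ℕ∞) ≤ (qExpansion 1 F).order :=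
    PowerSeries.le_order _ _ fun i hi => hdvd i (by exact_mod_cast hi)
  have h0 : F = 0 := ModularForm.sturm_bound_levelOne
    (lt_of_lt_of_le (by exact_mod_cast hn) hord)
  simp [h0]

lemma coeff_zero_mul_eq (p r : PowerSeries ℂ) : (p * r).coeff 0 = p.coeff 0 * r.coeff 0 := by
  simp

lemma coeff_zero_eisTwoSeries : eisTwoSeries.coeff 0 = 1 := by simp [eisTwoSeries]

lemma coeff_one_eisTwoSeries : eisTwoSeries.coeff 1 = -24 := by simp [eisTwoSeries]

lemma exists_hasQSeries_Eis_four :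
    ∃ p, HasQSeries p (Eis 4) ∧ p.coeff 0 = 1 ∧ p.coeff 1 = 240 := by
  rw [Eis_eq_E (k := 4) (by norm_num) ⟨2, rfl⟩]
  exact ⟨_, ModularForm.hasQSeries _, EisensteinSeries.E_qExpansion_coeff_zero _ ⟨2, rfl⟩,
    ModularForm.E₄_qExpansion_coeff_one⟩

lemma exists_hasQSeries_Eis_six :
    ∃ p, HasQSeries p (Eis 6) ∧ p.coeff 0 = 1 ∧ p.coeff 1 = -504 := by
  rw [Eis_eq_E (k := 6) (by norm_num) ⟨3, rfl⟩]
  exact ⟨_, ModularForm.hasQSeries _, EisensteinSeries.E_qExpansion_coeff_zero _ ⟨3, rfl⟩,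
    ModularForm.E₆_qExpansion_coeff_one⟩

/-- Ramanujan's identity `12 E₂' = E₂² - E₄`. -/
lemma qderiv_Eis_two (z : ℍ) : qderiv (Eis 2) z = (Eis 2 z ^ 2 - Eis 4 z) / 12 := by
  obtain ⟨p, hp, h0, -⟩ := exists_hasQSeries_Eis_four
  have hmem := Mset.add serre_one_Eis_two_mem (Mset.smul (1 / 12) Eis_four_mem_Mset)
  have hser := (hasQSeries_Eis_two.serre 1).add (hp.smul (1 / 12))
  have hzero := congrFun (Mset.eq_zero_of_X_pow_dvd hmem hser (n := 1) (by norm_num) (by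
    rw [pow_one, PowerSeries.X_dvd_iff, ← PowerSeries.coeff_zero_eq_constantCoeff_apply]
    simp only [map_add, map_sub, map_smul, coeff_qD, coeff_zero_mul_eq,
      coeff_zero_eisTwoSeries, h0, smul_eq_mul]
    norm_num)) z
  simp only [serre, Pi.add_apply, Pi.smul_apply, smul_eq_mul, Pi.zero_apply] at hzero
  push_cast at hzero
  linear_combination hzero

lemma HasQSeries.qderiv_add {p r : PowerSeries ℂ} {f g : ℍ → ℂ} (hf : HasQSeries p f)
    (hg : HasQSeries r g) : _root_.qderiv (f + g) = _root_.qderiv f + _root_.qderiv g :=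
  (qD_add p r ▸ (hf.add hg).qderiv).eq_fun (hf.qderiv.add hg.qderiv)

lemma HasQSeries.qderiv_mul {p r : PowerSeries ℂ} {f g : ℍ → ℂ} (hf : HasQSeries p f)
    (hg : HasQSeries r g) :
    _root_.qderiv (f * g) = f * _root_.qderiv g + _root_.qderiv f * g :=
  (qD_mul p r ▸ (hf.mul hg).qderiv).eq_fun ((hf.mul hg.qderiv).add (hf.qderiv.mul hg))

/-- The linear map `(h₀, h₁) ↦ h₀ + E₂ h₁` parametrizing quasimodular forms of depth one. -/
noncomputable def depthOneMap (w : ℤ) :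
    (ModularForm 𝒮ℒ w × ModularForm 𝒮ℒ (w - 2)) →ₗ[ℂ] (ℍ → ℂ) where
  toFun h := ⇑h.1 + Eis 2 * ⇑h.2
  map_add' h h' := by
    ext z
    simp
    ring
  map_smul' c h := by
    ext z
    simp
    ring

lemma QM_one_eq_range (w : ℤ) : QM w 1 = (depthOneMap w).range := by
  rw [QM, show QMset w 1 = (depthOneMap w).range from ?_, Submodule.span_eq]
  ext f
  simp only [QMset, SetLike.mem_coe, LinearMap.mem_range, Set.mem_ofPred_eq]
  constructor
  · rintro ⟨h, hmem, hsum⟩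
    have e0 : w - 2 * ((0 : ℕ) : ℤ) = w := by norm_num
    have e1 : w - 2 * ((1 : ℕ) : ℤ) = w - 2 := by norm_num
    obtain ⟨F', hF'⟩ := mem_Mset_iff.mp (e0 ▸ hmem 0 (by norm_num))
    obtain ⟨G', hG'⟩ := mem_Mset_iff.mp (e1 ▸ hmem 1 le_rfl)
    refine ⟨(F', G'), funext fun z => ?_⟩
    simp [depthOneMap, hsum z, Finset.sum_range_succ, hF', hG']
  · rintro ⟨⟨F, G⟩, rfl⟩
    refine ⟨fun l => if l = 0 then F else G, fun l hl => ?_, fun z => ?_⟩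
    · interval_cases l
      · simpa using F.mem_Mset
      · simpa using G.mem_Mset
    · simp [depthOneMap, Finset.sum_range_succ]

lemma mem_QM_one_iff {w : ℤ} {f : ℍ → ℂ} :
    f ∈ QM w 1 ↔ ∃ g ∈ Mset w, ∃ h ∈ Mset (w - 2), f = g + Eis 2 * h := by
  rw [QM_one_eq_range, LinearMap.mem_range]
  constructor
  · rintro ⟨⟨F, G⟩, rfl⟩
    exact ⟨F, F.mem_Mset, G, G.mem_Mset, rfl⟩
  · rintro ⟨g, hg, h, hh, rfl⟩
    obtain ⟨F, rfl⟩ := mem_Mset_iff.mp hg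
    obtain ⟨G, rfl⟩ := mem_Mset_iff.mp hh
    exact ⟨(F, G), rfl⟩

lemma depthOneMap_injective (w : ℤ) : Function.Injective (depthOneMap w) := by
  rw [← LinearMap.ker_eq_bot, LinearMap.ker_eq_bot']
  rintro ⟨F, G⟩ hFG
  have hFG' : ⇑F + Eis 2 * ⇑G = 0 := hFG
  have hG : ∀ z, G z = 0 := fun z => by
    have h := congrFun (congrArg (fun g => g ∣[w] ModularGroup.S) hFG') z
    have hmul := congrFun (ModularForm.mul_slash_SL2 2 (w - 2) ModularGroup.S (Eis 2) G) z
    rw [add_sub_cancel] at hmul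
    simp only [SlashAction.add_slash, Pi.add_apply, SlashAction.zero_slash, hmul, Pi.mul_apply,
      Mset.slash F.mem_Mset, Mset.slash G.mem_Mset, Eis_two_slash, Pi.zero_apply] at h
    have h' := congrFun hFG' z
    simp only [Pi.add_apply, Pi.mul_apply, Pi.zero_apply] at h'
    have hne : 6 * Complex.I / π * ((ModularGroup.S 1 0 : ℤ) / denom ModularGroup.S z) ≠ 0 := by
      simp [ModularGroup.S, denom_ne_zero, Real.pi_ne_zero]
    refine (mul_eq_zero.mp ?_).resolve_left hne
    linear_combination h' - h
  have hF : ∀ z, F z = 0 := fun z => by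
    have h' := congrFun hFG' z
    simpa [hG z] using h'
  exact Prod.ext (DFunLike.ext _ _ hF) (DFunLike.ext _ _ hG)

lemma finrank_modularForm_levelOne {w : ℕ} (he : Even w) :
    Module.finrank ℂ (ModularForm 𝒮ℒ (w : ℤ)) =
      if w % 12 = 2 then w / 12 else w / 12 + 1 := by
  have h := ModularForm.dimension_level_one w he
  rw [← Module.finrank_eq_rank] at h
  simp only [Nat.ModEq, Nat.reduceMod] at h
  exact_mod_cast h

lemma dimQM_one {w : ℤ} (hw : 6 ≤ w) (he : Even w) : dimQM w 1 = (w / 6).toNat + 1 := by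
  rw [dimQM, QM_one_eq_range, LinearMap.finrank_range_of_inj (depthOneMap_injective w),
    Module.finrank_prod]
  obtain ⟨m, hm⟩ := Int.eq_ofNat_of_zero_le (show 0 ≤ w - 2 by lia)
  obtain rfl : w = ((m + 2 : ℕ) : ℤ) := by push_cast; lia
  rw [hm, finrank_modularForm_levelOne (by exact_mod_cast he),
    finrank_modularForm_levelOne (by rw [Nat.even_iff]; rw [Int.even_iff] at he; lia)]
  rw [Int.even_iff] at he
  split_ifs <;> lia

lemma exists_eq_X_pow_mul {p : PowerSeries ℂ} (hp : p ≠ 0) :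
    ∃ (n : ℕ) (u : PowerSeries ℂ), p = PowerSeries.X ^ n * u ∧ u.coeff 0 ≠ 0 :=
  ⟨p.order.toNat, p.divXPowOrder, PowerSeries.X_pow_order_mul_divXPowOrder.symm, by
    rwa [PowerSeries.coeff_zero_eq_constantCoeff_apply, Ne,
      PowerSeries.constantCoeff_divXPowOrder_eq_zero_iff]⟩

lemma wronskian_ne_zero {u v : PowerSeries ℂ} {m n : ℕ} (hmn : m < n) (hu : u.coeff 0 ≠ 0)
    (hv : v.coeff 0 ≠ 0) {p h : PowerSeries ℂ} (hp : p = PowerSeries.X ^ n * u)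
    (hh : h = PowerSeries.X ^ m * v) :
    p * p + (12 : ℂ) • (p * qD h - h * qD p) ≠ 0 := by
  obtain ⟨d, rfl⟩ := Nat.exists_eq_add_of_lt hmn
  have key : p * p + (12 : ℂ) • (p * qD h - h * qD p) =
      PowerSeries.X ^ (m + d + 1 + m) * (PowerSeries.X * (PowerSeries.X ^ d * (u * u)) +
        (12 : ℂ) • (u * (qD v + (m : ℂ) • v) - v * (qD u + ((m + d + 1 : ℕ) : ℂ) • u))) := by
    rw [hp, hh, qD_X_pow_mul, qD_X_pow_mul]
    simp only [PowerSeries.smul_eq_C_mul]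
    ring
  intro h0
  have h1 := (mul_eq_zero.mp (key.symm.trans h0)).resolve_left
    (pow_ne_zero _ PowerSeries.X_ne_zero)
  have h2 := congrArg (PowerSeries.coeff 0) h1
  simp only [map_add, map_sub, map_smul, coeff_zero_mul_eq, coeff_qD, smul_eq_mul,
    PowerSeries.coeff_zero_X, map_zero] at h2
  have h3 : ((d : ℂ) + 1) * (u.coeff 0 * v.coeff 0) = 0 := by
    push_cast at h2
    linear_combination (-1 / 12) * h2
  exact mul_ne_zero (by exact_mod_cast d.succ_ne_zero) (mul_ne_zero hu hv) h3

lemma HasQSeries.zero : HasQSeries 0 0 := fun z => by simp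

/-- The Wronskian-type form attached to a depth one quasimodular form is modular. -/
lemma wronskian_mem_Mset {w : ℤ} {g h : ℍ → ℂ} (hg : g ∈ Mset w) (hh : h ∈ Mset (w - 2)) :
    (g + Eis 2 * h) * (g + Eis 2 * h) + (12 : ℂ) • ((g + Eis 2 * h) * qderiv h -
      h * qderiv (g + Eis 2 * h)) ∈ Mset (2 * w) := by
  obtain ⟨G, hG⟩ := Mset.exists_hasQSeries hg
  obtain ⟨H, hH⟩ := Mset.exists_hasQSeries hh
  have hmem : g * g + h * h * Eis 4 + (12 : ℂ) • (g * serre (w - 2) h - h * serre w g) ∈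
      Mset (2 * w) :=
    Mset.add (Mset.add (Mset.mul (by ring) hg hg)
      (Mset.mul (by ring) (Mset.mul rfl hh hh) Eis_four_mem_Mset))
      (Mset.smul _ (Mset.sub (Mset.mul (by ring) hg (Mset.serre hh))
        (Mset.mul (by ring) hh (Mset.serre hg))))
  convert hmem using 1
  ext z
  rw [hG.qderiv_add (hasQSeries_Eis_two.mul hH), hasQSeries_Eis_two.qderiv_mul hH]
  simp only [Pi.add_apply, Pi.mul_apply, Pi.sub_apply, Pi.smul_apply, smul_eq_mul, serre,
    qderiv_Eis_two]
  push_cast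
  ring

lemma eq_zero_of_mem_QM_one {w : ℤ} {f : ℍ → ℂ} {p : PowerSeries ℂ}
    (hf : f ∈ QM w 1) (hp : HasQSeries p f)
    (hdvd : PowerSeries.X ^ ((w / 6).toNat + 1) ∣ p) : f = 0 := by
  obtain ⟨g, hg, h, hh, rfl⟩ := mem_QM_one_iff.mp hf
  obtain ⟨H, hH⟩ := Mset.exists_hasQSeries hh
  have hser := (hp.mul hp).add (((hp.mul hH.qderiv).sub (hH.mul hp.qderiv)).smul 12)
  have hdvd' : PowerSeries.X ^ ((w / 6).toNat + 1) ∣ qD p := by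
    obtain ⟨r, rfl⟩ := hdvd
    exact qD_X_pow_mul _ r ▸ dvd_mul_right _ _
  have hW := Mset.eq_zero_of_X_pow_dvd (wronskian_mem_Mset hg hh) hser
    (n := (w / 6).toNat + 1) (by lia)
    (dvd_add (hdvd.mul_right _) (dvd_smul_of_dvd _ (dvd_sub (hdvd.mul_right _)
      (hdvd'.mul_left _))))
  rw [hW] at hser
  have hW0 := hser.eq_series HasQSeries.zero
  by_contra hne
  have hp0 : p ≠ 0 := by
    rintro rfl
    exact hne (hp.eq_fun HasQSeries.zero)
  have hH0 : H ≠ 0 := by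
    rintro rfl
    simp [qD, hp0] at hW0
  have hh0 : h ≠ 0 := by
    rintro rfl
    exact hH0 (hH.eq_series HasQSeries.zero)
  obtain ⟨n, u, hpu, hu⟩ := exists_eq_X_pow_mul hp0
  obtain ⟨m, v, hHv, hv⟩ := exists_eq_X_pow_mul hH0
  refine wronskian_ne_zero (lt_of_le_of_lt (?_ : m ≤ (w - 2).toNat / 12) ?_) hu hv hpu hHv hW0
  · by_contra! hm
    exact hh0 (Mset.eq_zero_of_X_pow_dvd hh hH (Nat.lt_succ_self _)
      ((pow_dvd_pow _ hm).trans ⟨v, hHv⟩))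
  · by_contra! hn
    have := PowerSeries.X_pow_dvd_iff.mp hdvd n (by lia)
    rw [hpu, PowerSeries.coeff_X_pow_mul'] at this
    exact hu (by simpa using this)

lemma serre_mem_QM_one {w : ℤ} {f : ℍ → ℂ} (hf : f ∈ QM w 1) :
    serre (w - 1) f ∈ QM (w + 2) 1 := by
  obtain ⟨g, hg, h, hh, rfl⟩ := mem_QM_one_iff.mp hf
  obtain ⟨G, hG⟩ := Mset.exists_hasQSeries hg
  obtain ⟨H, hH⟩ := Mset.exists_hasQSeries hh
  refine mem_QM_one_iff.mpr ⟨serre w g - (1 / 12 : ℂ) • (Eis 4 * h),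
    Mset.sub (Mset.serre hg) (Mset.smul _ (Mset.mul (by ring) Eis_four_mem_Mset hh)),
    (1 / 12 : ℂ) • g + serre (w - 2) h,
    Mset.add (Mset.smul _ (by rwa [add_sub_cancel_right])) ?_, ?_⟩
  · rw [add_sub_right_comm]
    exact Mset.serre hh
  · ext z
    simp only [serre, Pi.add_apply, Pi.mul_apply, Pi.sub_apply, Pi.smul_apply, smul_eq_mul]
    rw [hG.qderiv_add (hasQSeries_Eis_two.mul hH), hasQSeries_Eis_two.qderiv_mul hH]
    simp only [Pi.add_apply, Pi.mul_apply, qderiv_Eis_two]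
    push_cast
    ring

lemma mul_mem_QM_one {k w l : ℤ} (hl : k + w = l) {e f : ℍ → ℂ} (he : e ∈ Mset k)
    (hf : f ∈ QM w 1) : e * f ∈ QM l 1 := by
  obtain ⟨g, hg, h, hh, rfl⟩ := mem_QM_one_iff.mp hf
  exact mem_QM_one_iff.mpr ⟨e * g, Mset.mul hl he hg, e * h, Mset.mul (by lia) he hh, by ring⟩

lemma IsNormalizedExtremalQM.exists_hasQSeries {w : ℤ} (hw : 6 ≤ w) (he : Even w) {f : ℍ → ℂ}
    (hf : IsNormalizedExtremalQM w 1 f) {n : ℕ} (hn : (w / 6).toNat = n) :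
    ∃ u : PowerSeries ℂ, HasQSeries (PowerSeries.X ^ n * u) f ∧ u.coeff 0 = 1 := by
  obtain ⟨-, a, ha, hsum⟩ := hf
  rw [dimQM_one hw he, hn, Nat.add_sub_cancel] at hsum
  refine ⟨.mk a, fun z => ?_, by simpa using ha⟩
  rw [← (add_right_injective n).hasSum_iff]
  · convert! hsum z using 2 with m
    simp [PowerSeries.coeff_X_pow_mul']
  · intro m hm
    have : ¬ n ≤ m := fun h => hm ⟨m - n, by simp [h]⟩
    simp [PowerSeries.coeff_X_pow_mul', this]

/-- A depth one quasimodular form vanishing to the extremal order is a multiple of the normalized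
extremal form. -/
lemma IsNormalizedExtremalQM.eq_smul {w : ℤ} (hw : 6 ≤ w) (he : Even w) {f g : ℍ → ℂ}
    (hf : IsNormalizedExtremalQM w 1 f) (hg : g ∈ QM w 1) {n : ℕ} (hn : (w / 6).toNat = n)
    {v : PowerSeries ℂ} (hv : HasQSeries (PowerSeries.X ^ n * v) g) :
    g = v.coeff 0 • f := by
  obtain ⟨u, hu, hu0⟩ := hf.exists_hasQSeries hw he hn
  rw [← sub_eq_zero]
  refine eq_zero_of_mem_QM_one (sub_mem hg (Submodule.smul_mem _ _ hf.1))
    (hv.sub (hu.smul _)) ?_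
  rw [hn, ← mul_smul_comm, ← mul_sub, pow_succ]
  refine mul_dvd_mul_left _ (PowerSeries.X_dvd_iff.mpr ?_)
  rw [← PowerSeries.coeff_zero_eq_constantCoeff_apply]
  simp only [map_sub, map_smul, smul_eq_mul, hu0, mul_one, sub_self]

lemma coeff_one_mul_eq (p r : PowerSeries ℂ) :
    (p * r).coeff 1 = p.coeff 1 * r.coeff 0 + r.coeff 1 * p.coeff 0 := by
  simpa using PowerSeries.coeff_one_mul p r

lemma HasQSeries.exists_serre (k : ℤ) {n : ℕ} {u : PowerSeries ℂ} {f : ℍ → ℂ}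
    (hf : HasQSeries (PowerSeries.X ^ n * u) f) :
    ∃ v : PowerSeries ℂ, HasQSeries (PowerSeries.X ^ n * v) (_root_.serre k f) ∧
      v.coeff 0 = (n - k / 12) * u.coeff 0 ∧
      v.coeff 1 = (n + 1 - k / 12) * u.coeff 1 + 2 * k * u.coeff 0 := by
  refine ⟨qD u + (n : ℂ) • u - ((k : ℂ) / 12) • (eisTwoSeries * u), ?_, ?_, ?_⟩
  · rw [mul_sub, ← qD_X_pow_mul, mul_smul_comm, mul_left_comm]
    exact hf.serre k
  · simp only [map_add, map_sub, map_smul, coeff_qD, coeff_zero_mul_eq, coeff_zero_eisTwoSeries,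
      smul_eq_mul, Nat.cast_zero]
    ring
  · simp only [map_add, map_sub, map_smul, coeff_qD, coeff_one_mul_eq, coeff_zero_eisTwoSeries,
      coeff_one_eisTwoSeries, smul_eq_mul, Nat.cast_one]
    ring

lemma HasQSeries.mul_X_pow_mul {n : ℕ} {p u : PowerSeries ℂ} {e f : ℍ → ℂ} (he : HasQSeries p e)
    (hf : HasQSeries (PowerSeries.X ^ n * u) f) :
    HasQSeries (PowerSeries.X ^ n * (p * u)) (e * f) := by
  rw [mul_left_comm]
  exact he.mul hf

lemma eq_X_mul_of_coeff_zero {p : PowerSeries ℂ} (hp : p.coeff 0 = 0) :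
    ∃ r : PowerSeries ℂ, p = PowerSeries.X * r ∧ r.coeff 0 = p.coeff 1 := by
  rw [PowerSeries.coeff_zero_eq_constantCoeff_apply, ← PowerSeries.X_dvd_iff] at hp
  obtain ⟨r, rfl⟩ := hp
  exact ⟨r, rfl, (PowerSeries.coeff_succ_X_mul 0 r).symm⟩

/-- Proposition 7 of the paper: recursions for the normalized extremal
quasimodular forms of depth `1`. -/
theorem depth_one_recursions (f : ℤ → ℍ → ℂ)
    (hf : ∀ w : ℤ, Even w → 6 ≤ w → IsNormalizedExtremalQM w 1 (f w)) :
    (∀ z : ℍ, f 6 z = (Eis 2 z * Eis 4 z - Eis 6 z) / 720) ∧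
    ∀ w : ℤ, 6 ≤ w → w % 6 = 0 →
      ((∀ z : ℍ, f (w + 6) z =
          ((w : ℂ) + 6) / (72 * ((w : ℂ) + 1) * ((w : ℂ) + 5)) *
            (Eis 4 z * serre (w - 1) (f w) z - ((w : ℂ) + 1) / 12 * Eis 6 z * f w z)) ∧
       (∀ z : ℍ, f (w + 2) z = 12 / ((w : ℂ) + 1) * serre (w - 1) (f w) z) ∧
       (∀ z : ℍ, f (w + 4) z = Eis 4 z * f w z)) := by
  obtain ⟨p₄, hp₄, hp₄0, hp₄1⟩ := exists_hasQSeries_Eis_four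
  obtain ⟨p₆, hp₆, hp₆0, hp₆1⟩ := exists_hasQSeries_Eis_six
  refine ⟨fun z => ?_, fun w hw hw6 => ?_⟩
  · obtain ⟨r, hr, hr0⟩ := eq_X_mul_of_coeff_zero (p := eisTwoSeries * p₄ - p₆) (by
      simp only [map_sub, coeff_zero_mul_eq, coeff_zero_eisTwoSeries, hp₄0, hp₆0]
      norm_num)
    simp only [map_sub, coeff_one_mul_eq, coeff_zero_eisTwoSeries, coeff_one_eisTwoSeries,
      hp₄0, hp₄1, hp₆1] at hr0
    have hser := (hasQSeries_Eis_two.mul hp₄).sub hp₆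
    rw [hr, ← pow_one PowerSeries.X] at hser
    have hmem : Eis 2 * Eis 4 - Eis 6 ∈ QM 6 1 :=
      mem_QM_one_iff.mpr ⟨(-1 : ℂ) • Eis 6, Mset.smul _ Eis_six_mem_Mset, Eis 4,
        by simpa using Eis_four_mem_Mset, by rw [neg_one_smul]; ring⟩
    have h := congrFun ((hf 6 (by decide) le_rfl).eq_smul le_rfl (by decide) hmem rfl hser) z
    simp only [Pi.sub_apply, Pi.mul_apply, Pi.smul_apply, smul_eq_mul, hr0] at h
    linear_combination (-1 / 720) * h
  obtain ⟨n, rfl⟩ : ∃ n : ℕ, w = 6 * n := ⟨(w / 6).toNat, by lia⟩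
  have h₀ := hf (6 * n) (by grind) hw
  have h₂ := hf (6 * n + 2) (by grind) (by lia)
  have h₄ := hf (6 * n + 4) (by grind) (by lia)
  have h₆ := hf (6 * n + 6) (by grind) (by lia)
  obtain ⟨u, hu, hu0⟩ := h₀.exists_hasQSeries hw (by grind) (n := n) (by lia)
  obtain ⟨v, hv, hv0, hv1⟩ := hu.exists_serre (6 * n - 1)
  obtain ⟨x, hx, hx0, hx1⟩ := hv.exists_serre (6 * n + 2 - 1)
  have hE₄f := hp₄.mul_X_pow_mul hu
  have hDf := serre_mem_QM_one h₀.1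
  have c1 : (6 * (n : ℂ) + 1) ≠ 0 := by exact_mod_cast (6 * n).succ_ne_zero
  have c5 : (6 * (n : ℂ) + 5) ≠ 0 := by exact_mod_cast (6 * n + 4).succ_ne_zero
  push_cast at hv0 hv1 hx0 hx1 ⊢
  have weight_four : Eis 4 * f (6 * n) = f (6 * n + 4) := by
    rw [h₄.eq_smul (by lia) (by grind) (mul_mem_QM_one (by ring) Eis_four_mem_Mset h₀.1)
      (by lia) hE₄f, coeff_zero_mul_eq, hp₄0, hu0, one_mul, one_smul]
  have hDDf := serre_mem_QM_one hDf
  rw [add_assoc _ 2 2] at hDDf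
  have hode := h₄.eq_smul (by lia) (by grind) hDDf (by lia) hx
  rw [← weight_four] at hode
  have hseries : x = x.coeff 0 • (p₄ * u) := by
    refine mul_left_cancel₀ (pow_ne_zero n PowerSeries.X_ne_zero) ?_
    rw [mul_smul_comm]
    exact hx.eq_series (hode ▸ hE₄f.smul (x.coeff 0))
  have hcoeff := congrArg (PowerSeries.coeff 1) hseries
  simp only [map_smul, coeff_one_mul_eq, hp₄0, hp₄1, hu0, smul_eq_mul] at hcoeff
  rw [hx1, hx0, hv1, hv0, hu0] at hcoeff
  have hu1 : (n + 1) * u.coeff 1 = 48 * (n : ℂ) ^ 2 - 12 * n := by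
    linear_combination hcoeff
  have hG := (hp₄.mul_X_pow_mul hv).sub ((hp₆.mul_X_pow_mul hu).smul ((6 * (n : ℂ) + 1) / 12))
  rw [← mul_smul_comm, ← mul_sub] at hG
  obtain ⟨r, hr, hr0⟩ := eq_X_mul_of_coeff_zero
    (p := p₄ * v - ((6 * (n : ℂ) + 1) / 12) • (p₆ * u)) (by
      simp only [map_sub, map_smul, coeff_zero_mul_eq, hp₄0, hp₆0, hu0, hv0, smul_eq_mul]
      ring)
  rw [hr, ← mul_assoc, ← pow_succ] at hG
  simp only [map_sub, map_smul, coeff_one_mul_eq, hp₄0, hp₄1, hp₆0, hp₆1, hu0, hv0, hv1,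
    smul_eq_mul] at hr0
  have hmem : Eis 4 * serre (6 * n - 1) (f (6 * n)) -
      ((6 * (n : ℂ) + 1) / 12) • (Eis 6 * f (6 * n)) ∈ QM (6 * n + 6) 1 :=
    sub_mem (mul_mem_QM_one (by ring) Eis_four_mem_Mset hDf)
      (Submodule.smul_mem _ _ (mul_mem_QM_one (by ring) Eis_six_mem_Mset h₀.1))
  refine ⟨fun z => ?_, fun z => ?_, fun z => congrFun weight_four.symm z⟩
  · have h := congrFun (h₆.eq_smul (by lia) (by grind) hmem (by lia) hG) z
    have hr0' : (6 * (n : ℂ) + 6) * r.coeff 0 = 72 * (6 * n + 1) * (6 * n + 5) := by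
      rw [hr0]
      linear_combination 6 * hu1
    simp only [Pi.sub_apply, Pi.mul_apply, Pi.smul_apply, smul_eq_mul] at h
    rw [div_mul_eq_mul_div, eq_div_iff (by simp [c1, c5]), ← hr0']
    linear_combination -(6 * (n : ℂ) + 6) * h
  · have h := congrFun (h₂.eq_smul (by lia) (by grind) hDf (by lia) hv) z
    rw [Pi.smul_apply, smul_eq_mul, hv0, hu0] at h
    rw [h]
    field_simp
    ring
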